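/- arXiv:1801.06659 — 8 statements merged into one kernel-verified Lean document; each statement's English description precedes it below -/
import Mathlib

section
/- (Explicit positive classical solution in a ball.) Let N ≥ 2, let 1 ≤ k ≤ N−1 be an integer, let p ∈ (0,1) and R > 0. The function v(x) = [ ((1−p)/(2k)) (R² − |x|²) ]^{1/(1−p)} is twice continuously differentiable and strictly positive on the open ball B_R = {x ∈ ℝ^N : |x| < R}, extends continuously by 0 to the boundary |x| = R, and satisfies P⁻_k(D²v(x)) + v(x)^p = 0 for every x ∈ B_R. -/
open Matrix

/-- The eigenvalues of a real symmetric matrix, arranged in nondecreasing order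
(and `0` if the matrix is not symmetric). -/
noncomputable def sortedEig {N : ℕ} (A : Matrix (Fin N) (Fin N) ℝ) : Fin N → ℝ :=
  if hA : A.IsHermitian then hA.eigenvalues ∘ Tuple.sort hA.eigenvalues else 0

/-- `P⁻ₖ(A)`: the sum of the `k` smallest eigenvalues. -/
noncomputable def Pminus {N : ℕ} (k : ℕ) (A : Matrix (Fin N) (Fin N) ℝ) : ℝ :=
  ∑ i : Fin N, if (i : ℕ) < k then sortedEig A i else 0

/-- `P⁺ₖ(A)`: the sum of the `k` largest eigenvalues. -/
noncomputable def Pplus {N : ℕ} (k : ℕ) (A : Matrix (Fin N) (Fin N) ℝ) : ℝ :=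
  ∑ i : Fin N, if N - k ≤ (i : ℕ) then sortedEig A i else 0

/-- The Hessian matrix of `u : ℝᴺ → ℝ` at `x`. -/
noncomputable def hessianMatrix {N : ℕ} (u : EuclideanSpace ℝ (Fin N) → ℝ)
    (x : EuclideanSpace ℝ (Fin N)) : Matrix (Fin N) (Fin N) ℝ :=
  Matrix.of fun i j =>
    fderiv ℝ (fun y => fderiv ℝ u y (EuclideanSpace.single j 1)) x (EuclideanSpace.single i 1)

/-- The entries `eₗᵀ (a + b x xᵀ) eⱼ` in an orthonormal eigenbasis, computed in two ways. -/
lemma eigenvalues_smul_one_add_vecMulVec {N : ℕ} {a b : ℝ} {x : Fin N → ℝ}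
    (hA : (a • (1 : Matrix (Fin N) (Fin N) ℝ) + b • vecMulVec x x).IsHermitian) (j l : Fin N) :
    (hA.eigenvalues j - a) * (if l = j then 1 else 0) =
      b * (x ⬝ᵥ ⇑(hA.eigenvectorBasis j)) * (x ⬝ᵥ ⇑(hA.eigenvectorBasis l)) := by
  have h := congrArg (fun w => ⇑(hA.eigenvectorBasis l) ⬝ᵥ w) (hA.mulVec_eigenvectorBasis j)
  have ho : ⇑(hA.eigenvectorBasis l) ⬝ᵥ ⇑(hA.eigenvectorBasis j) =
      if l = j then (1 : ℝ) else 0 := by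
    rw [← orthonormal_iff_ite.mp hA.eigenvectorBasis.orthonormal l j,
      EuclideanSpace.inner_eq_star_dotProduct, star_trivial, dotProduct_comm]
  simp only [add_mulVec, smul_mulVec, one_mulVec, vecMulVec_mulVec, dotProduct_add,
    dotProduct_smul, ho, smul_eq_mul, op_smul_eq_smul] at h
  rw [dotProduct_comm _ x] at h
  linarith

/-- All but the largest eigenvalue of `a + b x xᵀ`, with `b ≥ 0`, are equal to `a`. -/
lemma sortedEig_smul_one_add_vecMulVec {N : ℕ} {a b : ℝ} (hb : 0 ≤ b) (x : Fin N → ℝ)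
    (i : Fin N) (hi : (i : ℕ) + 1 < N) :
    sortedEig (a • (1 : Matrix (Fin N) (Fin N) ℝ) + b • vecMulVec x x) i = a := by
  have hA : (a • (1 : Matrix (Fin N) (Fin N) ℝ) + b • vecMulVec x x).IsHermitian := by
    ext i j
    simp [vecMulVec_apply, one_apply, eq_comm, mul_comm]
  have hdiag (j : Fin N) : hA.eigenvalues j - a = b * (x ⬝ᵥ ⇑(hA.eigenvectorBasis j)) ^ 2 := by
    simpa [sq, mul_assoc] using eigenvalues_smul_one_add_vecMulVec hA j j
  have hge (j : Fin N) : a ≤ hA.eigenvalues j := by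
    have : 0 ≤ hA.eigenvalues j - a := hdiag j ▸ by positivity
    linarith
  have hoff (j l : Fin N) (hjl : l ≠ j) :
      (hA.eigenvalues j - a) * (hA.eigenvalues l - a) = 0 := by
    have h := eigenvalues_smul_one_add_vecMulVec hA j l
    rw [if_neg hjl, mul_zero] at h
    rw [hdiag, hdiag]
    linear_combination -(b * (x ⬝ᵥ ⇑(hA.eigenvectorBasis j)) *
      (x ⬝ᵥ ⇑(hA.eigenvectorBasis l))) * h
  rw [sortedEig, dif_pos hA]
  set σ := Tuple.sort hA.eigenvalues
  have hmono : hA.eigenvalues (σ i) ≤ hA.eigenvalues (σ ⟨i + 1, hi⟩) :=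
    Tuple.monotone_sort hA.eigenvalues (Fin.le_def.mpr (Nat.le_succ _))
  have hne : σ ⟨i + 1, hi⟩ ≠ σ i := fun h => by
    simpa using congrArg Fin.val (σ.injective h)
  change hA.eigenvalues (σ i) = a
  rcases mul_eq_zero.mp (hoff _ _ hne) with h | h
  · linarith
  · linarith [hge (σ i)]

/-- `P⁻ₖ(a + b x xᵀ) = k a` when `b ≥ 0` and `k < N`. -/
lemma Pminus_smul_one_add_vecMulVec {N k : ℕ} (hk : k < N) {a b : ℝ} (hb : 0 ≤ b)
    (x : Fin N → ℝ) :
    Pminus k (a • (1 : Matrix (Fin N) (Fin N) ℝ) + b • vecMulVec x x) = k * a := by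
  have h (i : Fin N) :
      (if (i : ℕ) < k then
        sortedEig (a • (1 : Matrix (Fin N) (Fin N) ℝ) + b • vecMulVec x x) i else 0) =
      if (i : ℕ) < k then a else 0 := by
    split_ifs with hi
    · exact sortedEig_smul_one_add_vecMulVec hb x i (by omega)
    · rfl
  rw [Pminus, Finset.sum_congr rfl fun i _ => h i, ← Finset.sum_filter, Finset.sum_const,
    Fin.card_filter_val_lt, min_eq_right hk.le, nsmul_eq_mul]

section RadialPower

variable {N : ℕ} {c R : ℝ}

lemma hasFDerivAt_rpow_sub_norm_sq (r : ℝ) {x : EuclideanSpace ℝ (Fin N)}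
    (hx : 0 < c * (R ^ 2 - ‖x‖ ^ 2)) :
    HasFDerivAt (fun y : EuclideanSpace ℝ (Fin N) => (c * (R ^ 2 - ‖y‖ ^ 2)) ^ r)
      ((-(2 * c * r) * (c * (R ^ 2 - ‖x‖ ^ 2)) ^ (r - 1)) • innerSL ℝ x) x := by
  have h := (((hasStrictFDerivAt_norm_sq x).hasFDerivAt.const_sub (R ^ 2)).const_mul
    c).rpow_const (p := r) (Or.inl hx.ne')
  refine h.congr_fderiv ?_
  ext z
  simp
  ring

lemma hessianMatrix_rpow_sub_norm_sq (r : ℝ) {x : EuclideanSpace ℝ (Fin N)}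
    (hx : 0 < c * (R ^ 2 - ‖x‖ ^ 2)) :
    hessianMatrix (fun y : EuclideanSpace ℝ (Fin N) => (c * (R ^ 2 - ‖y‖ ^ 2)) ^ r) x =
      (-(2 * c * r) * (c * (R ^ 2 - ‖x‖ ^ 2)) ^ (r - 1)) • (1 : Matrix (Fin N) (Fin N) ℝ) +
      ((2 * c) ^ 2 * r * (r - 1) * (c * (R ^ 2 - ‖x‖ ^ 2)) ^ (r - 1 - 1)) •
        vecMulVec (⇑x) (⇑x) := by
  have hpos : ∀ᶠ y : EuclideanSpace ℝ (Fin N) in nhds x, 0 < c * (R ^ 2 - ‖y‖ ^ 2) :=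
    ContinuousAt.eventually_lt (by fun_prop) (by fun_prop) hx
  ext i j
  have hgrad : (fun y => fderiv ℝ (fun y : EuclideanSpace ℝ (Fin N) =>
        (c * (R ^ 2 - ‖y‖ ^ 2)) ^ r) y (EuclideanSpace.single j 1)) =ᶠ[nhds x]
      fun y => (-(2 * c * r) * (c * (R ^ 2 - ‖y‖ ^ 2)) ^ (r - 1)) *
        (EuclideanSpace.proj j : EuclideanSpace ℝ (Fin N) →L[ℝ] ℝ) y := by
    filter_upwards [hpos] with y hy
    rw [(hasFDerivAt_rpow_sub_norm_sq r hy).fderiv]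
    simp [EuclideanSpace.inner_single_right]
  have hder := ((hasFDerivAt_rpow_sub_norm_sq (r - 1) hx).const_mul (-(2 * c * r))).mul
    (EuclideanSpace.proj j : EuclideanSpace ℝ (Fin N) →L[ℝ] ℝ).hasFDerivAt
  rw [hessianMatrix, of_apply, (hder.congr_of_eventuallyEq hgrad).fderiv]
  simp [EuclideanSpace.inner_single_right, vecMulVec_apply, one_apply, eq_comm]
  ring

end RadialPower

/-- **explicit positive classical solution in a ball.** For `p ∈ (0,1)`,
`v(x) = [((1-p)/(2k))(R² - |x|²)]^{1/(1-p)}` is `C²` and positive in `B_R`, vanishes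
continuously on `|x| = R`, and solves `P⁻ₖ(D²v) + vᵖ = 0` in `B_R`. -/
theorem explicit_solution_in_ball {N : ℕ} (hN : 2 ≤ N) (k : ℕ)
    (hk1 : 1 ≤ k) (hkN : k ≤ N - 1) (p R : ℝ) (hp : p ∈ Set.Ioo (0 : ℝ) 1) (hR : 0 < R)
    (v : EuclideanSpace ℝ (Fin N) → ℝ)
    (hv : ∀ x, v x = ((1 - p) / (2 * k) * (R ^ 2 - ‖x‖ ^ 2)) ^ (1 / (1 - p))) :
    ContDiffOn ℝ 2 v (Metric.ball (0 : EuclideanSpace ℝ (Fin N)) R) ∧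
    (∀ x ∈ Metric.ball (0 : EuclideanSpace ℝ (Fin N)) R, 0 < v x) ∧
    ContinuousOn v (Metric.closedBall (0 : EuclideanSpace ℝ (Fin N)) R) ∧
    (∀ x : EuclideanSpace ℝ (Fin N), ‖x‖ = R → v x = 0) ∧
    (∀ x ∈ Metric.ball (0 : EuclideanSpace ℝ (Fin N)) R,
      Pminus k (hessianMatrix v x) + v x ^ p = 0) := by
  obtain ⟨hp0, hp1⟩ := hp
  have hk0 : (0 : ℝ) < k := by exact_mod_cast hk1
  have hq : 0 < 1 - p := by linarith
  have hc : 0 < (1 - p) / (2 * k) := by positivity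
  have hpos : ∀ x ∈ Metric.ball (0 : EuclideanSpace ℝ (Fin N)) R,
      0 < (1 - p) / (2 * k) * (R ^ 2 - ‖x‖ ^ 2) := fun x hx => by
    rw [mem_ball_zero_iff] at hx
    exact mul_pos hc (sub_pos.mpr (by gcongr))
  obtain rfl : v = fun x => ((1 - p) / (2 * k) * (R ^ 2 - ‖x‖ ^ 2)) ^ (1 / (1 - p)) := funext hv
  refine ⟨?_, fun x hx => Real.rpow_pos_of_pos (hpos x hx) _, ?_, fun x hx => ?_, fun x hx => ?_⟩
  · refine ContDiffOn.rpow_const_of_ne (ContDiff.contDiffOn ?_) fun x hx => (hpos x hx).ne'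
    exact contDiff_const.mul (contDiff_const.sub (contDiff_norm_sq ℝ))
  · exact ContinuousOn.rpow_const (by fun_prop) fun _ _ => Or.inr (by positivity)
  · have : 1 / (1 - p) ≠ 0 := by positivity
    simp only [hx, sub_self, mul_zero]
    exact Real.zero_rpow this
  · have hexp : 1 / (1 - p) - 1 = 1 / (1 - p) * p := by
      field_simp
      ring
    have hexp_nonneg : 0 ≤ 1 / (1 - p) - 1 := hexp ▸ by positivity
    have hg := hpos x hx
    rw [hessianMatrix_rpow_sub_norm_sq _ hg, Pminus_smul_one_add_vecMulVec (by omega)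
      (by positivity), ← Real.rpow_mul hg.le, ← hexp]
    have hcoef : (k : ℝ) * (2 * ((1 - p) / (2 * k)) * (1 / (1 - p))) = 1 := by
      field_simp
    linear_combination -((1 - p) / (2 * k) * (R ^ 2 - ‖x‖ ^ 2)) ^ (1 / (1 - p) - 1) * hcoef
end

section
/- (Entire Gaussian solution of the limit equation.) Let N ≥ 2 and let 1 ≤ k ≤ N−1 be an integer. The function u(x) = exp(−|x|²/(2k)) is smooth on ℝ^N and satisfies P⁻_k(D²u(x)) + u(x) = 0 for every x ∈ ℝ^N. -/
open Matrix

/-- If all values of `f` are at least `a` and at most one index has a value different from `a`,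
then every entry of the sorted tuple except possibly the last one equals `a`. -/
theorem sort_apply_eq_of_subsingleton_ne {N : ℕ} (f : Fin N → ℝ) (a : ℝ) (hle : ∀ i, a ≤ f i)
    (hne : ∀ i j, f i ≠ a → f j ≠ a → i = j) (i : Fin N) (hi : (i : ℕ) + 1 < N) :
    f (Tuple.sort f i) = a := by
  by_contra h
  let l : Fin N := ⟨i + 1, hi⟩
  have hil : i ≤ l := Fin.le_def.2 (Nat.le_succ _)
  have hmono : f (Tuple.sort f i) ≤ f (Tuple.sort f l) := Tuple.monotone_sort f hil
  have hlt : a < f (Tuple.sort f i) := lt_of_le_of_ne (hle _) (Ne.symm h)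
  have heq := (Tuple.sort f).injective (hne _ _ h (hlt.trans_le hmono).ne')
  have : (i : ℕ) = i + 1 := congrArg Fin.val heq
  omega

/-- For `k < N`, the sum of the `k` smallest eigenvalues of `a I + b x xᵀ` with `b ≥ 0` is
`k a`. -/
theorem Pminus_smul_one_add_smul_vecMulVec {N : ℕ} (k : ℕ) (hk : k < N) (a b : ℝ) (hb : 0 ≤ b)
    (x : Fin N → ℝ) :
    Pminus k (a • (1 : Matrix (Fin N) (Fin N) ℝ) + b • vecMulVec x x) = k * a := by
  set A := a • (1 : Matrix (Fin N) (Fin N) ℝ) + b • vecMulVec x x with hAdef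
  have hA : A.IsHermitian := by
    ext i j
    simp [hAdef, vecMulVec_apply, one_apply, eq_comm, mul_comm]
  let v : Fin N → Fin N → ℝ := fun i => (hA.eigenvectorBasis i).ofLp
  have horth : ∀ i j, v j ⬝ᵥ v i = if i = j then 1 else 0 := fun i j => by
    have := orthonormal_iff_ite.1 hA.eigenvectorBasis.orthonormal i j
    simpa [v, EuclideanSpace.inner_eq_star_dotProduct] using this
  have hmul : ∀ i j, hA.eigenvalues i * (v j ⬝ᵥ v i) =
      a * (v j ⬝ᵥ v i) + b * ((x ⬝ᵥ v i) * (x ⬝ᵥ v j)) := fun i j => by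
    have h : A *ᵥ v i = hA.eigenvalues i • v i := hA.mulVec_eigenvectorBasis i
    have h' := congrArg (fun w => v j ⬝ᵥ w) h
    simp only [hAdef, add_mulVec, smul_mulVec, one_mulVec, vecMulVec_mulVec, dotProduct_add,
      dotProduct_smul, smul_eq_mul, op_smul_eq_smul, dotProduct_comm (v j) x] at h'
    exact h'.symm
  have heig : ∀ i, hA.eigenvalues i = a + b * ((x ⬝ᵥ v i) * (x ⬝ᵥ v i)) := fun i => by
    have := hmul i i
    rw [horth] at this
    simpa using this
  have hsort : ∀ i : Fin N, (i : ℕ) < k → sortedEig A i = a := fun i hi => by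
    rw [sortedEig, dif_pos hA]
    refine sort_apply_eq_of_subsingleton_ne _ a (fun i => ?_) (fun i j hi hj => ?_) i (by omega)
    · rw [heig]
      exact le_add_of_nonneg_right (mul_nonneg hb (mul_self_nonneg _))
    · by_contra hij
      have h := hmul i j
      rw [horth, if_neg hij] at h
      rw [heig] at hi hj
      have h0 : b * ((x ⬝ᵥ v i) * (x ⬝ᵥ v j)) = 0 := by linarith
      rcases mul_eq_zero.1 h0 with h0 | h0
      · exact hi (by simp [h0])
      · rcases mul_eq_zero.1 h0 with h0 | h0
        · exact hi (by simp [h0])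
        · exact hj (by simp [h0])
  have hsum : Pminus k A = ∑ i : Fin N, if (i : ℕ) < k then a else 0 :=
    Finset.sum_congr rfl fun i _ => by
      split_ifs with hi
      · exact hsort i hi
      · rfl
  rw [hsum, Fin.sum_univ_eq_sum_range (fun i => if i < k then a else 0), ← Finset.sum_filter,
    Finset.sum_const, nsmul_eq_mul]
  congr 2
  rw [show (Finset.range N).filter (· < k) = Finset.range k by ext i; simp; omega,
    Finset.card_range]

/-- The derivative of a centered Gaussian. -/
theorem hasFDerivAt_exp_neg_norm_sq_div {E : Type*} [NormedAddCommGroup E] [InnerProductSpace ℝ E]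
    (c : ℝ) (y : E) :
    HasFDerivAt (fun y : E => Real.exp (-‖y‖ ^ 2 / (2 * c)))
      ((-(Real.exp (-‖y‖ ^ 2 / (2 * c)) / c)) • innerSL ℝ y) y := by
  have h := (((hasStrictFDerivAt_norm_sq y).hasFDerivAt.neg).mul_const (2 * c)⁻¹).exp
  refine h.congr_fderiv ?_
  ext w
  simp [div_eq_mul_inv]
  ring

/-- The Hessian of a centered Gaussian. -/
theorem hessianMatrix_exp_neg_norm_sq_div {N : ℕ} (c : ℝ) (x : EuclideanSpace ℝ (Fin N)) :
    hessianMatrix (fun y => Real.exp (-‖y‖ ^ 2 / (2 * c))) x =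
      (-(Real.exp (-‖x‖ ^ 2 / (2 * c)) / c)) • (1 : Matrix (Fin N) (Fin N) ℝ) +
        (Real.exp (-‖x‖ ^ 2 / (2 * c)) / c ^ 2) • vecMulVec x.ofLp x.ofLp := by
  ext i j
  have hfst : (fun y : EuclideanSpace ℝ (Fin N) =>
      fderiv ℝ (fun y => Real.exp (-‖y‖ ^ 2 / (2 * c))) y (EuclideanSpace.single j 1)) =
      fun y => Real.exp (-‖y‖ ^ 2 / (2 * c)) * (-c⁻¹ * y j) := by
    funext y
    rw [(hasFDerivAt_exp_neg_norm_sq_div c y).fderiv]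
    simp [EuclideanSpace.inner_single_right]
    ring
  have hcoord : HasFDerivAt (fun y : EuclideanSpace ℝ (Fin N) => y j)
      (EuclideanSpace.proj j : EuclideanSpace ℝ (Fin N) →L[ℝ] ℝ) x :=
    (EuclideanSpace.proj j : EuclideanSpace ℝ (Fin N) →L[ℝ] ℝ).hasFDerivAt
  have hsnd := (hasFDerivAt_exp_neg_norm_sq_div c x).mul (hcoord.const_mul (-c⁻¹))
  rw [hessianMatrix, of_apply, hfst]
  erw [hsnd.fderiv]
  simp [EuclideanSpace.inner_single_right, vecMulVec_apply, one_apply, eq_comm (a := j)]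
  split_ifs <;> ring

/-- **entire Gaussian solution of the limit equation.**
`u(x) = exp(-|x|²/(2k))` is smooth and solves `P⁻ₖ(D²u) + u = 0` in `ℝ^N`. -/
theorem gaussian_entire_solution {N : ℕ} (hN : 2 ≤ N) (k : ℕ)
    (hk1 : 1 ≤ k) (hkN : k ≤ N - 1)
    (u : EuclideanSpace ℝ (Fin N) → ℝ)
    (hu : ∀ x, u x = Real.exp (-‖x‖ ^ 2 / (2 * k))) :
    ContDiff ℝ (⊤ : ℕ∞) u ∧
    ∀ x : EuclideanSpace ℝ (Fin N), Pminus k (hessianMatrix u x) + u x = 0 := by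
  obtain rfl : u = fun x => Real.exp (-‖x‖ ^ 2 / (2 * k)) := funext hu
  refine ⟨((contDiff_norm_sq ℝ).neg.div_const _).exp, fun x => ?_⟩
  have hk : (k : ℝ) ≠ 0 := by positivity
  rw [hessianMatrix_exp_neg_norm_sq_div,
    Pminus_smul_one_add_smul_vecMulVec k (by omega) _ _ (by positivity)]
  field_simp
  ring
end

section
/- (Radial ODE form of P⁻_k, Lemma 5.1.) Let k ≥ 1 be an integer and let f : [0,∞) → ℝ be continuously differentiable with f(t) ≥ 0 and f'(t) ≥ 0 for all t ≥ 0. Let u : [0,∞) → ℝ be twice continuously differentiable with u(r) ≥ 0 for all r ≥ 0, u'(0) = 0, and lim_{r→0⁺} u'(r)/r = u''(0). Assume that for every r > 0, min( k·u'(r)/r , (k−1)·u'(r)/r + u''(r) ) + f(u(r)) = 0. Then u'(r)/r ≤ u''(r) for every r > 0, and consequently k·u'(r)/r + f(u(r)) = 0 for every r > 0. -/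
open Set Filter

open Topology in
/-- A function on `(0, ∞)` with limit `0` at `0⁺` and nonpositive derivative wherever it is
positive is nonpositive. -/
theorem nonpos_of_tendsto_zero_of_deriv_nonpos {g g' : ℝ → ℝ}
    (hlim : Tendsto g (𝓝[>] 0) (𝓝 0))
    (hd : ∀ r > 0, HasDerivAt g (g' r) r)
    (hg' : ∀ r > 0, 0 < g r → g' r ≤ 0) {r : ℝ} (hr : 0 < r) : g r ≤ 0 := by
  have key : ∀ ε > 0, g r ≤ ε * (1 + r) := by
    intro ε hε
    obtain ⟨a, ha, ha0, har⟩ := ((hlim.eventually_lt_const hε).and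
      (Ioo_mem_nhdsGT hr)).exists
    refine image_le_of_deriv_right_lt_deriv_boundary' (f := g) (f' := g')
      (B := fun x => ε * (1 + x)) (B' := fun _ => ε) (a := a) (b := r)
      (fun x hx => (hd x (ha0.trans_le hx.1)).continuousAt.continuousWithinAt)
      (fun x hx => (hd x (ha0.trans_le hx.1)).hasDerivWithinAt) ?_ (by fun_prop) ?_ ?_
      (right_mem_Icc.2 har.le)
    · nlinarith
    · intro x _
      simpa using (((hasDerivAt_id x).const_add 1).const_mul ε).hasDerivWithinAt
    · intro x hx hgx
      have hx0 : 0 < x := ha0.trans_le hx.1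
      have hpos : 0 < g x := by rw [hgx]; positivity
      exact (hg' x hx0 hpos).trans_lt hε
  refine le_of_forall_pos_le_add fun ε hε => ?_
  have h := key (ε / (1 + r)) (by positivity)
  rw [div_mul_cancel₀ _ (by positivity)] at h
  simpa using h

/-- **radial ODE form of `P⁻ₖ`, Lemma 5.1.** If a nonnegative `C²` radial
profile `u` solves `min(k u'/r, (k-1) u'/r + u'') + f(u) = 0` for `r > 0`, with `f ≥ 0`
nondecreasing and `C¹`, then `u'/r ≤ u''` and hence `k u'/r + f(u) = 0` for all `r > 0`. -/
theorem radial_ode_form (k : ℕ) (hk : 1 ≤ k) (f f' u u' u'' : ℝ → ℝ)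
    (hfd : ∀ t ∈ Ici (0 : ℝ), HasDerivWithinAt f (f' t) (Ici 0) t)
    (hf'c : ContinuousOn f' (Ici 0))
    (hf0 : ∀ t ∈ Ici (0 : ℝ), 0 ≤ f t)
    (hf'0 : ∀ t ∈ Ici (0 : ℝ), 0 ≤ f' t)
    (hud : ∀ r ∈ Ici (0 : ℝ), HasDerivWithinAt u (u' r) (Ici 0) r)
    (hu'd : ∀ r ∈ Ici (0 : ℝ), HasDerivWithinAt u' (u'' r) (Ici 0) r)
    (hu''c : ContinuousOn u'' (Ici 0))
    (hu0 : ∀ r ∈ Ici (0 : ℝ), 0 ≤ u r)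
    (hu'0 : u' 0 = 0)
    (hlim : Tendsto (fun r => u' r / r) (nhdsWithin 0 (Ioi 0)) (nhds (u'' 0)))
    (heq : ∀ r > (0 : ℝ),
      min (k * u' r / r) (((k : ℝ) - 1) * u' r / r + u'' r) + f (u r) = 0) :
    ∀ r > (0 : ℝ), u' r / r ≤ u'' r ∧ k * u' r / r + f (u r) = 0 := by
  have hk1 : (1 : ℝ) ≤ k := by exact_mod_cast hk
  have hu'_at : ∀ r > 0, HasDerivAt u' (u'' r) r := fun r hr =>
    (hu'd r (mem_Ici.2 hr.le)).hasDerivAt (Ici_mem_nhds hr)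
  have hle : nhdsWithin (0 : ℝ) (Ioi 0) ≤ nhdsWithin 0 (Ici 0) :=
    nhdsWithin_mono _ Ioi_subset_Ici_self
  have h0 : (0 : ℝ) ∈ Ici (0 : ℝ) := self_mem_Ici
  have hu'_nonpos : ∀ r > 0, u' r ≤ 0 := by
    intro r hr
    refine nonpos_of_tendsto_zero_of_deriv_nonpos (g' := u'') ?_ hu'_at ?_ hr
    · simpa [ContinuousWithinAt, hu'0] using (hu'd 0 h0).continuousWithinAt.mono_left hle
    · intro x hx hpos
      have hf := hf0 (u x) (hu0 x hx.le)
      have h1 : 0 < k * u' x / x := by positivity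
      have h2 : 0 ≤ ((k : ℝ) - 1) * u' x / x :=
        div_nonneg (mul_nonneg (by linarith) hpos.le) hx.le
      rcases min_choice (k * u' x / x) (((k : ℝ) - 1) * u' x / x + u'' x) with h | h <;>
        have := heq x hx <;> rw [h] at this <;> linarith
  have hfu : Tendsto (fun r => f (u r)) (nhdsWithin 0 (Ioi 0)) (nhds (f (u 0))) :=
    ((hfd (u 0) (hu0 0 h0)).continuousWithinAt.comp (hud 0 h0).continuousWithinAt
      (fun r hr => hu0 r hr)).mono_left hle
  have hku : Tendsto (fun r => k * u' r / r) (nhdsWithin 0 (Ioi 0)) (nhds (k * u'' 0)) := by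
    simpa only [mul_div_assoc] using hlim.const_mul (k : ℝ)
  have hzero : k * u'' 0 + f (u 0) = 0 := by
    have hk1u : Tendsto (fun r => ((k : ℝ) - 1) * u' r / r + u'' r) (nhdsWithin 0 (Ioi 0))
        (nhds (((k : ℝ) - 1) * u'' 0 + u'' 0)) := by
      simpa only [mul_div_assoc] using
        (hlim.const_mul ((k : ℝ) - 1)).add ((hu''c 0 h0).mono_left hle)
    have hL := (hku.min hk1u).add hfu
    have hev : ∀ᶠ r in nhdsWithin (0 : ℝ) (Ioi 0),
        min (k * u' r / r) (((k : ℝ) - 1) * u' r / r + u'' r) + f (u r) = 0 :=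
      eventually_nhdsWithin_of_forall heq
    have h := tendsto_nhds_unique (hL.congr' hev) tendsto_const_nhds
    rwa [show ((k : ℝ) - 1) * u'' 0 + u'' 0 = k * u'' 0 by ring, min_self] at h
  have hsplit : ∀ r, ((k : ℝ) - 1) * u' r / r = k * u' r / r - u' r / r := fun r => by ring
  have hg_nonpos : ∀ r > 0, k * u' r / r + f (u r) ≤ 0 := by
    intro r hr
    refine nonpos_of_tendsto_zero_of_deriv_nonpos (g := fun r => k * u' r / r + f (u r))
      (g' := fun r => (k * u'' r * r - k * u' r * 1) / r ^ 2 + f' (u r) * u' r) ?_ ?_ ?_ hr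
    · simpa only [hzero] using hku.add hfu
    · intro x hx
      refine (((hu'_at x hx).const_mul (k : ℝ)).div (hasDerivAt_id x) hx.ne').add ?_
      have h := (hfd (u x) (hu0 x hx.le)).comp x (hud x hx.le) (fun r hr => hu0 r hr)
      exact h.hasDerivAt (Ici_mem_nhds hx)
    · intro x hx hpos
      have hlt : u'' x < u' x / x := by
        by_contra! hge
        have h := heq x hx
        rw [min_eq_left (by rw [hsplit]; linarith)] at h
        exact hpos.ne' h
      rw [lt_div_iff₀ hx] at hlt
      have h1 : (k * u'' x * x - k * u' x * 1) / x ^ 2 ≤ 0 :=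
        div_nonpos_of_nonpos_of_nonneg (by nlinarith) (by positivity)
      have h2 := mul_nonpos_of_nonneg_of_nonpos (hf'0 (u x) (hu0 x hx.le)) (hu'_nonpos x hx)
      exact add_nonpos h1 h2
  intro r hr
  have hmin := heq r hr
  have hg := hg_nonpos r hr
  have hl := min_le_left (k * u' r / r) (((k : ℝ) - 1) * u' r / r + u'' r)
  have hrt := min_le_right (k * u' r / r) (((k : ℝ) - 1) * u' r / r + u'' r)
  have hs := hsplit r
  constructor <;> linarith
end

section
/- (Uniqueness of radial profiles of the limit equation.) Let k ≥ 1 be an integer and let u : [0,∞) → ℝ be twice continuously differentiable with u(r) ≥ 0 for all r ≥ 0, u'(0) = 0, and lim_{r→0⁺} u'(r)/r = u''(0). Assume that for every r > 0, min( k·u'(r)/r , (k−1)·u'(r)/r + u''(r) ) + u(r) = 0. Then u(r) = u(0)·exp(−r²/(2k)) for all r ≥ 0. -/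
open Set Filter

/-- If `u' a ≤ 0` and `(r ^ m * u')' = -r ^ m * u` with `u ≥ 0` on `(a, b)`, then `u' ≤ 0` on
`(a, b)`. -/
lemma nonpos_of_radial_ode {m : ℕ} {u u' u'' : ℝ → ℝ} {a b : ℝ} (ha : 0 ≤ a)
    (hc : ContinuousOn u' (Icc a b)) (hd : ∀ r ∈ Ioo a b, HasDerivAt u' (u'' r) r)
    (hu : ∀ r ∈ Ioo a b, 0 ≤ u r) (hode : ∀ r ∈ Ioo a b, m * u' r / r + u'' r + u r = 0)
    (hua : u' a ≤ 0) : ∀ r ∈ Ioo a b, u' r ≤ 0 := by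
  intro r hr
  have hanti : AntitoneOn (fun x => x ^ m * u' x) (Icc a b) := by
    refine antitoneOn_of_hasDerivWithinAt_nonpos (f' := fun x => -(x ^ m * u x))
      (convex_Icc a b) (by fun_prop) ?_ ?_
    · rw [interior_Icc]
      intro x hx
      have hx0 : x ≠ 0 := (ha.trans_lt hx.1).ne'
      refine (((hasDerivAt_pow m x).mul (hd x hx)).congr_deriv ?_).hasDerivWithinAt
      have hu'' : u'' x = -(m * u' x / x) - u x := by linarith [hode x hx]
      rw [hu'']
      rcases m with _ | m
      · simp
      · simp only [Nat.add_sub_cancel]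
        field_simp
        ring
    · rw [interior_Icc]
      intro x hx
      have := mul_nonneg (pow_nonneg (ha.trans hx.1.le) m) (hu x hx)
      linarith
  have hle := hanti (left_mem_Icc.2 (hr.1.trans hr.2).le) (Ioo_subset_Icc_self hr) hr.1.le
  have h0 : a ^ m * u' a ≤ 0 := mul_nonpos_of_nonneg_of_nonpos (pow_nonneg ha m) hua
  have hpos : 0 < r ^ m := pow_pos (ha.trans_lt hr.1) m
  exact nonpos_of_mul_nonpos_right (hle.trans h0) hpos

/-- A continuous function which is nonpositive at `0` and positive at `b > 0` has a last point
before `b` where it is nonpositive. -/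
lemma exists_last_nonpos {v : ℝ → ℝ} {b : ℝ} (hb : 0 ≤ b) (hc : ContinuousOn v (Icc 0 b))
    (h0 : v 0 ≤ 0) (hvb : 0 < v b) :
    ∃ a, 0 ≤ a ∧ a < b ∧ v a ≤ 0 ∧ ∀ r ∈ Ioc a b, 0 < v r := by
  have hcl : IsClosed (Icc 0 b ∩ v ⁻¹' Iic 0) := hc.preimage_isClosed_of_isClosed isClosed_Icc
    isClosed_Iic
  have hcomp : IsCompact (Icc 0 b ∩ v ⁻¹' Iic 0) :=
    isCompact_Icc.of_isClosed_subset hcl inter_subset_left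
  obtain ⟨a, ⟨ha, hva⟩, hmax⟩ := hcomp.exists_isGreatest ⟨0, left_mem_Icc.2 hb, h0⟩
  refine ⟨a, ha.1, lt_of_le_of_ne ha.2 ?_, hva, fun r hr => ?_⟩
  · rintro rfl
    exact absurd hvb (not_lt.2 hva)
  · by_contra! h
    exact absurd (hmax ⟨⟨ha.1.trans hr.1.le, hr.2⟩, h⟩) (not_le.2 hr.1)

/-- **uniqueness of radial profiles of the limit equation.** If a
nonnegative `C²` radial profile `u` solves `min(k u'/r, (k-1) u'/r + u'') + u = 0` for
`r > 0`, then `u(r) = u(0) exp(-r²/(2k))`. -/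
theorem radial_profile_uniqueness (k : ℕ) (hk : 1 ≤ k) (u u' u'' : ℝ → ℝ)
    (hud : ∀ r ∈ Ici (0 : ℝ), HasDerivWithinAt u (u' r) (Ici 0) r)
    (hu'd : ∀ r ∈ Ici (0 : ℝ), HasDerivWithinAt u' (u'' r) (Ici 0) r)
    (hu''c : ContinuousOn u'' (Ici 0))
    (hu0 : ∀ r ∈ Ici (0 : ℝ), 0 ≤ u r)
    (hu'0 : u' 0 = 0)
    (hlim : Tendsto (fun r => u' r / r) (nhdsWithin 0 (Ioi 0)) (nhds (u'' 0)))
    (heq : ∀ r > (0 : ℝ),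
      min (k * u' r / r) (((k : ℝ) - 1) * u' r / r + u'' r) + u r = 0) :
    ∀ r ∈ Ici (0 : ℝ), u r = u 0 * Real.exp (-r ^ 2 / (2 * k)) := by
  have hk0 : (0 : ℝ) < k := by exact_mod_cast hk
  have huc : ContinuousOn u (Ici 0) := fun r hr => (hud r hr).continuousWithinAt
  have hu'c : ContinuousOn u' (Ici 0) := fun r hr => (hu'd r hr).continuousWithinAt
  have hudA : ∀ r > 0, HasDerivAt u (u' r) r := fun r hr =>
    (hud r hr.le).hasDerivAt (Ici_mem_nhds hr)
  have hu'dA : ∀ r > 0, HasDerivAt u' (u'' r) r := fun r hr =>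
    (hu'd r hr.le).hasDerivAt (Ici_mem_nhds hr)
  have hvc : ContinuousOn (fun r => k * u' r + r * u r) (Ici 0) := by fun_prop
  have hnonneg : ∀ r > 0, 0 ≤ k * u' r + r * u r := by
    intro r hr
    have h1 : 0 ≤ k * u' r / r + u r := by
      linarith [heq r hr, min_le_left (k * u' r / r) (((k : ℝ) - 1) * u' r / r + u'' r)]
    have h2 := mul_nonneg hr.le h1
    rwa [mul_add, mul_div_cancel₀ _ hr.ne'] at h2
  have hode : ∀ r > 0, 0 < k * u' r + r * u r → ((k : ℝ) - 1) * u' r / r + u'' r + u r = 0 := by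
    intro r hr hv
    rcases min_choice (k * u' r / r) (((k : ℝ) - 1) * u' r / r + u'' r) with h | h
    · have h1 := heq r hr
      rw [h] at h1
      field_simp at h1
      linarith
    · rw [← h]
      exact heq r hr
  have hzero : ∀ r > 0, k * u' r + r * u r = 0 := by
    intro b hb
    by_contra hne
    have hvb : 0 < k * u' b + b * u b := lt_of_le_of_ne (hnonneg b hb) (Ne.symm hne)
    obtain ⟨a, ha, hab, hva, hpos⟩ := exists_last_nonpos hb.le (hvc.mono Icc_subset_Ici_self)
      (by simp [hu'0]) hvb
    have hsub : Icc a b ⊆ Ici 0 := fun x hx => ha.trans hx.1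
    have hgt : ∀ r ∈ Ioo a b, 0 < r := fun r hr => ha.trans_lt hr.1
    have hua : u' a ≤ 0 := by
      have := mul_nonneg ha (hu0 a ha)
      exact nonpos_of_mul_nonpos_right (by linarith : k * u' a ≤ 0) hk0
    have hode' : ∀ r ∈ Ioo a b, ((k : ℝ) - 1) * u' r / r + u'' r + u r = 0 := fun r hr =>
      hode r (hgt r hr) (hpos r (Ioo_subset_Ioc_self hr))
    have hu'neg : ∀ r ∈ Ioo a b, u' r ≤ 0 :=
      nonpos_of_radial_ode (m := k - 1) ha (hu'c.mono hsub) (fun r hr => hu'dA r (hgt r hr))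
        (fun r hr => hu0 r (hgt r hr).le) (by simpa [Nat.cast_sub hk] using hode') hua
    have hanti : AntitoneOn (fun r => k * u' r + r * u r) (Icc a b) := by
      refine antitoneOn_of_hasDerivWithinAt_nonpos
        (f' := fun r => k * u'' r + (1 * u r + r * u' r)) (convex_Icc a b) (hvc.mono hsub) ?_ ?_
      · rw [interior_Icc]
        intro r hr
        exact (((hu'dA r (hgt r hr)).const_mul (k : ℝ)).add
          ((hasDerivAt_id r).mul (hudA r (hgt r hr)))).hasDerivWithinAt
      · rw [interior_Icc]
        intro r hr
        have hr0 := hgt r hr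
        have hu'' : u'' r = -(((k : ℝ) - 1) * u' r / r) - u r := by linarith [hode' r hr]
        have hk1 : (0 : ℝ) ≤ k - 1 := by
          have : (1 : ℝ) ≤ k := by exact_mod_cast hk
          linarith
        have hderiv : k * u'' r + (1 * u r + r * u' r) =
            -((k - 1) * (k * u' r + r * u r) / r) + r * u' r := by
          rw [hu'']
          field_simp
          ring
        have h1 : 0 ≤ ((k : ℝ) - 1) * (k * u' r + r * u r) / r :=
          div_nonneg (mul_nonneg hk1 (hnonneg r hr0)) hr0.le
        have h2 : r * u' r ≤ 0 := mul_nonpos_of_nonneg_of_nonpos hr0.le (hu'neg r hr)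
        linarith
    have hle := hanti (left_mem_Icc.2 hab.le) (right_mem_Icc.2 hab.le) hab.le
    dsimp only at hle
    linarith
  intro r hr
  have hconst : u r * Real.exp (r ^ 2 / (2 * k)) = u 0 * Real.exp (0 ^ 2 / (2 * k)) := by
    refine constant_of_has_deriv_right_zero (f := fun x => u x * Real.exp (x ^ 2 / (2 * k)))
      (a := 0) (b := r) ?_ ?_ r (right_mem_Icc.2 hr)
    · have : ContinuousOn u (Icc 0 r) := huc.mono Icc_subset_Ici_self
      fun_prop
    · intro x hx
      have hx0 : k * u' x + x * u x = 0 := by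
        rcases hx.1.eq_or_lt with h | h
        · simp [← h, hu'0]
        · exact hzero x h
      have hexp : HasDerivAt (fun x : ℝ => Real.exp (x ^ 2 / (2 * k)))
          (Real.exp (x ^ 2 / (2 * k)) * (x / k)) x := by
        refine (((hasDerivAt_pow 2 x).div_const (2 * (k : ℝ))).exp).congr_deriv ?_
        field_simp
        simp [mul_comm]
      refine (((hud x hx.1).mono (Ici_subset_Ici.2 hx.1)).mul hexp.hasDerivWithinAt).congr_deriv ?_
      have hu' : u' x = -(x * u x) / k := by
        rw [eq_div_iff hk0.ne']
        linarith
      rw [hu']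
      ring
  have h0 : u 0 * Real.exp (0 ^ 2 / (2 * k)) = u 0 := by simp
  rw [h0] at hconst
  rw [← hconst, mul_assoc, ← Real.exp_add]
  simp [neg_div]
end

section
/- (Anti-Hopf boundary decay.) Let N ≥ 2, k ≥ 1 an integer, p ∈ (0,1), R > 0, and let x₀ ∈ ℝ^N with |x₀| = R. Define v(x) = [ ((1−p)/(2k))(R² − |x|²) ]^{1/(1−p)} for |x| ≤ R. Then for every x with |x| ≤ R one has v(x) ≤ ( (1−p)R/k )^{1/(1−p)} |x − x₀|^{1/(1−p)}; consequently, for every exponent q < 1/(1−p), the quotient v(x)/|x−x₀|^q tends to 0 as x → x₀ with |x| ≤ R, x ≠ x₀. -/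
open Set Filter

/-- Points of the closed ball of radius `‖x₀‖` satisfy a linear bound on `‖x₀‖² - ‖x‖²`. -/
lemma norm_sq_sub_norm_sq_le {E : Type*} [SeminormedAddCommGroup E] {x x₀ : E}
    (hx : ‖x‖ ≤ ‖x₀‖) : ‖x₀‖ ^ 2 - ‖x‖ ^ 2 ≤ 2 * ‖x₀‖ * ‖x - x₀‖ := by
  have h : ‖x₀‖ - ‖x‖ ≤ ‖x - x₀‖ := by
    rw [norm_sub_rev]
    exact norm_sub_norm_le x₀ x
  nlinarith [norm_nonneg x, norm_nonneg x₀, norm_nonneg (x - x₀)]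

/-- A nonnegative function bounded by `C * ‖x - x₀‖ ^ a` on `s` is `o(‖x - x₀‖ ^ q)` at `x₀`
within `s \ {x₀}` for every `q < a`. -/
lemma tendsto_div_norm_sub_rpow_zero {E : Type*} [NormedAddCommGroup E] {f : E → ℝ} {s : Set E}
    {x₀ : E} {C a q : ℝ} (hf₀ : ∀ x ∈ s, 0 ≤ f x) (hf : ∀ x ∈ s, f x ≤ C * ‖x - x₀‖ ^ a)
    (hq : q < a) :
    Tendsto (fun x => f x / ‖x - x₀‖ ^ q) (nhdsWithin x₀ (s \ {x₀})) (nhds 0) := by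
  have hlim : Tendsto (fun x => C * ‖x - x₀‖ ^ (a - q)) (nhdsWithin x₀ (s \ {x₀})) (nhds 0) := by
    have hc : Continuous fun x : E => C * ‖x - x₀‖ ^ (a - q) :=
      continuous_const.mul
        ((continuous_id.sub continuous_const).norm.rpow_const fun _ => Or.inr (sub_pos.2 hq).le)
    have h := hc.tendsto x₀
    simp only [sub_self, norm_zero, Real.zero_rpow (sub_pos.2 hq).ne', mul_zero] at h
    exact h.mono_left nhdsWithin_le_nhds
  refine tendsto_of_tendsto_of_tendsto_of_le_of_le' tendsto_const_nhds hlim ?_ ?_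
  · filter_upwards [self_mem_nhdsWithin] with x hx
    exact div_nonneg (hf₀ x hx.1) (Real.rpow_nonneg (norm_nonneg _) _)
  · filter_upwards [self_mem_nhdsWithin] with x hx
    have hpos : 0 < ‖x - x₀‖ := norm_pos_iff.2 (sub_ne_zero.2 hx.2)
    rw [Real.rpow_sub hpos, ← mul_div_assoc]
    exact div_le_div_of_nonneg_right (hf x hx.1) (Real.rpow_nonneg hpos.le _)

/-- **anti-Hopf boundary decay.** The explicit solution
`v(x) = [((1-p)/(2k))(R²-|x|²)]^{1/(1-p)}` in `B_R` satisfies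
`v(x) ≤ ((1-p)R/k)^{1/(1-p)} |x - x₀|^{1/(1-p)}` for `|x| ≤ R` and any boundary point
`x₀`; hence `v(x)/|x-x₀|^q → 0` as `x → x₀` in the ball, for every `q < 1/(1-p)`. -/
theorem anti_hopf_decay {N : ℕ} (hN : 2 ≤ N) (k : ℕ) (hk : 1 ≤ k)
    (p R : ℝ) (hp : p ∈ Set.Ioo (0 : ℝ) 1) (hR : 0 < R)
    (x₀ : EuclideanSpace ℝ (Fin N)) (hx₀ : ‖x₀‖ = R)
    (v : EuclideanSpace ℝ (Fin N) → ℝ)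
    (hv : ∀ x, v x = ((1 - p) / (2 * k) * (R ^ 2 - ‖x‖ ^ 2)) ^ (1 / (1 - p))) :
    (∀ x : EuclideanSpace ℝ (Fin N), ‖x‖ ≤ R →
      v x ≤ ((1 - p) * R / k) ^ (1 / (1 - p)) * ‖x - x₀‖ ^ (1 / (1 - p))) ∧
    ∀ q : ℝ, q < 1 / (1 - p) →
      Tendsto (fun x => v x / ‖x - x₀‖ ^ q)
        (nhdsWithin x₀ (Metric.closedBall (0 : EuclideanSpace ℝ (Fin N)) R \ {x₀}))
        (nhds 0) := by
  have hp' : 0 < 1 - p := sub_pos.2 hp.2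
  have hk' : (0 : ℝ) < k := by exact_mod_cast hk
  have base_nonneg : ∀ x : EuclideanSpace ℝ (Fin N), ‖x‖ ≤ R →
      0 ≤ (1 - p) / (2 * k) * (R ^ 2 - ‖x‖ ^ 2) := fun x hx =>
    mul_nonneg (by positivity) (sub_nonneg.2 (pow_le_pow_left₀ (norm_nonneg x) hx 2))
  have bound : ∀ x : EuclideanSpace ℝ (Fin N), ‖x‖ ≤ R →
      v x ≤ ((1 - p) * R / k) ^ (1 / (1 - p)) * ‖x - x₀‖ ^ (1 / (1 - p)) := by
    intro x hx
    rw [hv, ← Real.mul_rpow (by positivity) (norm_nonneg _)]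
    refine Real.rpow_le_rpow (base_nonneg x hx) ?_ (by positivity)
    calc (1 - p) / (2 * k) * (R ^ 2 - ‖x‖ ^ 2)
        ≤ (1 - p) / (2 * k) * (2 * R * ‖x - x₀‖) := by
          subst hx₀
          exact mul_le_mul_of_nonneg_left (norm_sq_sub_norm_sq_le hx) (by positivity)
      _ = (1 - p) * R / k * ‖x - x₀‖ := by field_simp
  refine ⟨bound, fun q hq => tendsto_div_norm_sub_rpow_zero (fun x hx => ?_)
    (fun x hx => bound x (mem_closedBall_zero_iff.1 hx)) hq⟩
  rw [hv]
  exact Real.rpow_nonneg (base_nonneg x (mem_closedBall_zero_iff.1 hx)) _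
end

section
/- (Stability of the asymptotic profile under perturbations of the domain.) Let N ≥ 2 and k ≥ 1 an integer. For p ∈ (0,1) let x̄_p ∈ ℝ^N and ρ̄_p ≥ 0 satisfy |x̄_p| → 0 and ρ̄_p/√(1−p) → 0 as p → 1⁻. Define u_p(x) = [ ((1−p)/(2k)) ( ( √(2k/(1−p)) − ρ̄_p )² − |x − x̄_p|² ) ]^{1/(1−p)} for those x where the bracket is nonnegative. Then, as p → 1⁻, u_p converges to exp(−|x|²/(2k)) uniformly on every compact subset of ℝ^N (each compact set is contained in the ball {|x − x̄_p| < √(2k/(1−p)) − ρ̄_p} for p close enough to 1). -/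
open Set Filter

/-- The exponential limit `(1 + s g) ^ (1 / s) → exp L` as `s → 0⁺` and `g → L`,
along an arbitrary filter. -/
theorem tendsto_one_add_mul_rpow_one_div {α : Type*} {l : Filter α} {s g : α → ℝ} {L : ℝ}
    (hpos : ∀ᶠ a in l, 0 < s a) (hs : Tendsto s l (nhds 0)) (hg : Tendsto g l (nhds L)) :
    Tendsto (fun a => (1 + s a * g a) ^ (1 / s a)) l (nhds (Real.exp L)) := by
  have hz : Tendsto (fun a => 1 + s a * g a) l (nhds 1) := by
    simpa using (hs.mul hg).const_add 1
  have hd : ContinuousAt (dslope Real.log 1) 1 :=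
    continuousAt_dslope_same.2 (Real.differentiableAt_log one_ne_zero)
  have hlim : Tendsto (fun a => g a * dslope Real.log 1 (1 + s a * g a)) l (nhds L) := by
    have h := hg.mul (hd.tendsto.comp hz)
    simpa [dslope_same, Real.deriv_log] using h
  refine ((Real.continuous_exp.tendsto L).comp hlim).congr' ?_
  filter_upwards [hpos, hz.eventually (lt_mem_nhds one_pos)] with a ha hb
  have h := sub_smul_dslope Real.log 1 (1 + s a * g a)
  simp only [add_sub_cancel_left, smul_eq_mul, Real.log_one, sub_zero] at h
  rw [Real.rpow_def_of_pos hb, ← h, Function.comp_apply]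
  congr 1
  field_simp

/-- Joint convergence of `F p y` as `p` runs along `l` and `y → x`, for every `x`, to a continuous
limit gives uniform convergence on compact sets. -/
theorem IsCompact.tendstoUniformlyOn_of_forall_tendsto_prod {ι α β : Type*} [TopologicalSpace α]
    [UniformSpace β] {F : ι → α → β} {f : α → β} {l : Filter ι} {K : Set α} (hK : IsCompact K)
    (hf : Continuous f)
    (h : ∀ x, Tendsto (fun y : ι × α => F y.1 y.2) (l ×ˢ nhds x) (nhds (f x))) :
    TendstoUniformlyOn F f l K := by
  rw [← tendstoLocallyUniformlyOn_iff_tendstoUniformlyOn_of_compact hK,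
    tendstoLocallyUniformlyOn_iff_forall_tendsto]
  intro x _
  have hpair := (((hf.tendsto x).comp tendsto_snd).prodMk_nhds (h x)).mono_right
    (nhds_le_uniformity (f x))
  exact hpair.mono_left (Filter.prod_mono le_rfl nhdsWithin_le_nhds)

/-- The bracket of the explicit solution, as a perturbation of `1` of order `s = 1 - p`. -/
theorem div_mul_sqrt_sub_sq_sub_eq {c s : ℝ} (hc : 0 < c) (hs : 0 < s) (r d : ℝ) :
    s / c * ((√(c / s) - r) ^ 2 - d ^ 2) =
      1 + s * ((r ^ 2 - 2 * √c * (r / √s) - d ^ 2) / c) := by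
  have h : √(c / s) = √c / √s := Real.sqrt_div hc.le s
  have hsq : √(c / s) ^ 2 = c / s := Real.sq_sqrt (by positivity)
  calc s / c * ((√(c / s) - r) ^ 2 - d ^ 2)
      = s / c * (√(c / s) ^ 2 - 2 * √(c / s) * r + r ^ 2 - d ^ 2) := by ring
    _ = s / c * (c / s - 2 * (√c / √s) * r + r ^ 2 - d ^ 2) := by rw [hsq, h]
    _ = s / c * (c / s) + s / c * (r ^ 2 - 2 * √c * (r / √s) - d ^ 2) := by ring
    _ = _ := by
      rw [div_mul_div_cancel₀ hc.ne', div_self hs.ne']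
      ring

/-- **stability of the asymptotic profile under domain perturbations.**
If `|x̄_p| → 0` and `ρ̄_p/√(1-p) → 0` as `p → 1⁻`, then the explicit solutions in the
balls `B_{√(2k/(1-p)) - ρ̄_p}(x̄_p)` converge to `exp(-|x|²/(2k))` uniformly on every
compact subset of `ℝ^N`, each compact set being eventually inside the ball. -/
theorem asymptotic_profile_perturbed {N : ℕ} (hN : 2 ≤ N) (k : ℕ) (hk : 1 ≤ k)
    (xbar : ℝ → EuclideanSpace ℝ (Fin N)) (rho : ℝ → ℝ)
    (hrho : ∀ p ∈ Ioo (0 : ℝ) 1, 0 ≤ rho p)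
    (hx : Tendsto (fun p => ‖xbar p‖) (nhdsWithin 1 (Ioo 0 1)) (nhds 0))
    (hr : Tendsto (fun p => rho p / Real.sqrt (1 - p)) (nhdsWithin 1 (Ioo 0 1)) (nhds 0))
    (K : Set (EuclideanSpace ℝ (Fin N))) (hK : IsCompact K) :
    (∀ᶠ p in nhdsWithin (1 : ℝ) (Ioo 0 1), ∀ x ∈ K,
      ‖x - xbar p‖ < Real.sqrt (2 * k / (1 - p)) - rho p) ∧
    TendstoUniformlyOn
      (fun (p : ℝ) (x : EuclideanSpace ℝ (Fin N)) =>
        ((1 - p) / (2 * k) *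
          ((Real.sqrt (2 * k / (1 - p)) - rho p) ^ 2 - ‖x - xbar p‖ ^ 2)) ^ (1 / (1 - p)))
      (fun x => Real.exp (-‖x‖ ^ 2 / (2 * k)))
      (nhdsWithin (1 : ℝ) (Ioo 0 1)) K := by
  have hc : (0 : ℝ) < 2 * k := by positivity
  have hpos : ∀ᶠ p in nhdsWithin (1 : ℝ) (Ioo 0 1), 0 < 1 - p := by
    filter_upwards [self_mem_nhdsWithin] with p hp using sub_pos.2 hp.2
  have hs : Tendsto (fun p : ℝ => 1 - p) (nhdsWithin 1 (Ioo 0 1)) (nhds 0) := by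
    have h : Continuous fun p : ℝ => 1 - p := by fun_prop
    simpa using (h.tendsto 1).mono_left nhdsWithin_le_nhds
  have hrho0 : Tendsto rho (nhdsWithin 1 (Ioo 0 1)) (nhds 0) := by
    have h := hr.mul ((Real.continuous_sqrt.tendsto 0).comp hs)
    rw [zero_mul] at h
    refine h.congr' ?_
    filter_upwards [hpos] with p hp
    exact div_mul_cancel₀ _ (Real.sqrt_pos.2 hp).ne'
  refine ⟨?_, hK.tendstoUniformlyOn_of_forall_tendsto_prod (by fun_prop) fun x => ?_⟩
  · obtain ⟨M, hM⟩ := hK.isBounded.exists_norm_le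
    have hinv : Tendsto (fun p : ℝ => (1 - p)⁻¹) (nhdsWithin 1 (Ioo 0 1)) atTop :=
      tendsto_inv_nhdsGT_zero.comp (tendsto_nhdsWithin_iff.2 ⟨hs, hpos⟩)
    have hsqrt : Tendsto (fun p : ℝ => √(2 * k / (1 - p))) (nhdsWithin 1 (Ioo 0 1)) atTop :=
      Real.tendsto_sqrt_atTop.comp (hinv.const_mul_atTop hc)
    filter_upwards [hsqrt.eventually_gt_atTop (M + 2), hx.eventually (gt_mem_nhds one_pos),
      hrho0.eventually (gt_mem_nhds one_pos)] with p h₁ h₂ h₃ x hxK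
    linarith [norm_sub_le x (xbar p), hM x hxK]
  · have hfst : Tendsto Prod.fst (nhdsWithin (1 : ℝ) (Ioo 0 1) ×ˢ nhds x)
      (nhdsWithin (1 : ℝ) (Ioo 0 1)) := tendsto_fst
    have hdist : Tendsto (fun y : ℝ × EuclideanSpace ℝ (Fin N) => ‖y.2 - xbar y.1‖)
        (nhdsWithin (1 : ℝ) (Ioo 0 1) ×ˢ nhds x) (nhds ‖x‖) := by
      simpa using (tendsto_snd.sub ((tendsto_zero_iff_norm_tendsto_zero.2 hx).comp hfst)).norm
    have hg := ((((hrho0.comp hfst).pow 2).sub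
      ((hr.comp hfst).const_mul (2 * √(2 * k)))).sub (hdist.pow 2)).div_const (2 * (k : ℝ))
    have hlim := tendsto_one_add_mul_rpow_one_div (s := (fun p => 1 - p) ∘ Prod.fst)
      (hfst.eventually hpos) (hs.comp hfst) hg
    rw [show ((0 : ℝ) ^ 2 - 2 * √(2 * k) * 0 - ‖x‖ ^ 2) = -‖x‖ ^ 2 by ring] at hlim
    refine hlim.congr' ?_
    filter_upwards [hfst.eventually hpos] with y hy
    rw [div_mul_sqrt_sub_sq_sub_eq hc hy]
    rfl
end

section
/- (Classical maximum principle for P⁺_k with zero order term.) Let Ω ⊂ ℝ^N be a bounded open set with diameter d, let 1 ≤ k ≤ N be an integer, and let u be continuous on the closure of Ω and twice continuously differentiable in Ω. Let f : Ω → ℝ be continuous and bounded, and assume P⁺_k(D²u(x)) ≥ f(x) for every x ∈ Ω. Then sup_Ω u ≤ sup_{∂Ω} u + (d²/(2k)) · sup_Ω f⁻, where f⁻(x) = max(−f(x), 0) is the negative part of f. -/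
open Matrix

/-- The second derivative is nonpositive at a local maximum. -/
theorem IsLocalMax.deriv_deriv_nonpos {g : ℝ → ℝ} {x : ℝ} (h : IsLocalMax g x)
    (hc : ContinuousAt g x) : deriv (deriv g) x ≤ 0 := by
  by_contra! hpos
  have hmin := isLocalMin_of_deriv_deriv_pos hpos h.deriv_eq_zero hc
  have hconst : g =ᶠ[nhds x] fun _ => g x := by
    filter_upwards [h, hmin] with y h₁ h₂ using le_antisymm h₁ h₂
  have hzero : deriv (deriv g) x = 0 := by
    rw [hconst.deriv.deriv_eq]
    simp
  exact hpos.ne' hzero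

/-- An upper bound for the second derivative of `u` at a point where the sum of `u` and a
paraboloid has a local maximum. -/
theorem fderiv_fderiv_le_of_isLocalMax_add_sq {E : Type*} [NormedAddCommGroup E]
    [InnerProductSpace ℝ E] {u : E → ℝ} {x x₀ : E} {c : ℝ} (hu : ContDiffAt ℝ 2 u x)
    (hmax : IsLocalMax (fun y => u y + c / 2 * ‖y - x₀‖ ^ 2) x) (w : E) :
    fderiv ℝ (fderiv ℝ u) x w w ≤ -c * ‖w‖ ^ 2 := by
  set φ : E → ℝ := fun y => u y + c / 2 * ‖y - x₀‖ ^ 2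
  have hline : ∀ t : ℝ, HasDerivAt (fun s : ℝ => x + s • w) w t := fun t => by
    simpa using ((hasDerivAt_id t).smul_const w).const_add x
  have htend : Filter.Tendsto (fun s : ℝ => x + s • w) (nhds 0) (nhds x) := by
    simpa [ContinuousAt] using (hline 0).continuousAt
  have hdu : ∀ᶠ y in nhds x, DifferentiableAt ℝ u y :=
    (hu.eventually (by simp)).mono fun y hy => hy.differentiableAt (by simp)
  have hsq : ∀ t : ℝ, HasDerivAt (fun s : ℝ => c / 2 * ‖x + s • w - x₀‖ ^ 2)
      (c * inner ℝ (x + t • w - x₀) w) t := fun t => by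
    refine (((hline t).sub_const x₀).norm_sq.const_mul (c / 2)).congr_deriv ?_
    ring
  have hder : ∀ᶠ t in nhds (0 : ℝ), HasDerivAt (fun s : ℝ => φ (x + s • w))
      (fderiv ℝ u (x + t • w) w + c * inner ℝ (x + t • w - x₀) w) t := by
    filter_upwards [htend.eventually hdu] with t ht
    exact (ht.hasFDerivAt.comp_hasDerivAt t (hline t)).add (hsq t)
  have hd2 : DifferentiableAt ℝ (fderiv ℝ u) x :=
    (hu.fderiv_right (m := 1) (by norm_num)).differentiableAt (by simp)
  have hd2' : HasDerivAt
      (fun t : ℝ => fderiv ℝ u (x + t • w) w + c * inner ℝ (x + t • w - x₀) w)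
      (fderiv ℝ (fderiv ℝ u) x w w + c * ‖w‖ ^ 2) 0 := by
    have h₁ : HasFDerivAt (fderiv ℝ u) (fderiv ℝ (fderiv ℝ u) x) (x + (0 : ℝ) • w) := by
      simpa using hd2.hasFDerivAt
    have h₂ : HasDerivAt (fun t : ℝ => fderiv ℝ u (x + t • w) w)
        (fderiv ℝ (fderiv ℝ u) x w w) 0 :=
      (ContinuousLinearMap.apply ℝ ℝ w).hasFDerivAt.comp_hasDerivAt (0 : ℝ)
        (h₁.comp_hasDerivAt (0 : ℝ) (hline 0))
    have h₃ := (((hline 0).sub_const x₀).inner ℝ (hasDerivAt_const (0 : ℝ) w)).const_mul c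
    refine (h₂.add h₃).congr_deriv ?_
    rw [inner_zero_right, zero_add, real_inner_self_eq_norm_sq]
  have hmax0 : IsLocalMax (fun s : ℝ => φ (x + s • w)) 0 := by
    have := htend.eventually hmax
    simpa [IsLocalMax, IsMaxFilter] using this
  have hnonpos := hmax0.deriv_deriv_nonpos hder.self_of_nhds.continuousAt
  have hderiv : deriv (fun s : ℝ => φ (x + s • w)) =ᶠ[nhds 0]
      fun t => fderiv ℝ u (x + t • w) w + c * inner ℝ (x + t • w - x₀) w :=
    hder.mono fun t ht => ht.deriv
  rw [hderiv.deriv_eq, hd2'.deriv] at hnonpos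
  linarith

theorem hessianMatrix_apply {N : ℕ} {u : EuclideanSpace ℝ (Fin N) → ℝ}
    {x : EuclideanSpace ℝ (Fin N)} (hu : ContDiffAt ℝ 2 u x) (i j : Fin N) :
    hessianMatrix u x i j =
      fderiv ℝ (fderiv ℝ u) x (EuclideanSpace.single i 1) (EuclideanSpace.single j 1) := by
  have hd2 : DifferentiableAt ℝ (fderiv ℝ u) x :=
    (hu.fderiv_right (m := 1) (by norm_num)).differentiableAt (by simp)
  simp [hessianMatrix, fderiv_clm_apply hd2 (differentiableAt_const _)]

theorem isHermitian_hessianMatrix {N : ℕ} {u : EuclideanSpace ℝ (Fin N) → ℝ}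
    {x : EuclideanSpace ℝ (Fin N)} (hu : ContDiffAt ℝ 2 u x) :
    (hessianMatrix u x).IsHermitian := by
  refine Matrix.IsHermitian.ext fun i j => ?_
  rw [hessianMatrix_apply hu, hessianMatrix_apply hu, star_trivial]
  exact (hu.isSymmSndFDerivAt (by simp)) _ _

theorem dotProduct_hessianMatrix_mulVec {N : ℕ} {u : EuclideanSpace ℝ (Fin N) → ℝ}
    {x : EuclideanSpace ℝ (Fin N)} (hu : ContDiffAt ℝ 2 u x) (w : EuclideanSpace ℝ (Fin N)) :
    w.ofLp ⬝ᵥ (hessianMatrix u x *ᵥ w.ofLp) = fderiv ℝ (fderiv ℝ u) x w w := by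
  have hw : w = ∑ i, w i • EuclideanSpace.single i (1 : ℝ) := by
    simpa using ((EuclideanSpace.basisFun (Fin N) ℝ).sum_repr w).symm
  conv_rhs => rw [hw]
  simp only [map_sum, map_smul, _root_.sum_apply, _root_.smul_apply,
    dotProduct, Matrix.mulVec, hessianMatrix_apply hu, smul_eq_mul, Finset.mul_sum]
  rw [Finset.sum_comm]
  refine Finset.sum_congr rfl fun i _ => Finset.sum_congr rfl fun j _ => ?_
  ring

theorem Matrix.IsHermitian.eigenvalues_le {n : Type*} [Fintype n] [DecidableEq n]
    {A : Matrix n n ℝ} (hA : A.IsHermitian) {a : ℝ}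
    (h : ∀ w : EuclideanSpace ℝ n, w.ofLp ⬝ᵥ (A *ᵥ w.ofLp) ≤ a * ‖w‖ ^ 2) (i : n) :
    hA.eigenvalues i ≤ a := by
  have hi := h (hA.eigenvectorBasis i)
  rw [hA.mulVec_eigenvectorBasis, dotProduct_smul] at hi
  have hone : (hA.eigenvectorBasis i).ofLp ⬝ᵥ (hA.eigenvectorBasis i).ofLp = 1 := by
    have := EuclideanSpace.real_norm_sq_eq (hA.eigenvectorBasis i)
    simpa [dotProduct, pow_two] using this.symm
  simpa [hone] using hi

theorem Pplus_le {N k : ℕ} (hk1 : 1 ≤ k) (hkN : k ≤ N) {A : Matrix (Fin N) (Fin N) ℝ} {a : ℝ}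
    (h : ∀ i, sortedEig A i ≤ a) : Pplus k A ≤ k * a := by
  have hset : (Finset.univ.filter fun i : Fin N => N - k ≤ (i : ℕ)) =
      Finset.Ici ⟨N - k, by omega⟩ := by
    ext i
    simp [Fin.le_def]
  calc Pplus k A ≤ ∑ i : Fin N, if N - k ≤ (i : ℕ) then a else 0 := by
        refine Finset.sum_le_sum fun i _ => ?_
        split_ifs
        exacts [h i, le_rfl]
    _ = k * a := by
        rw [← Finset.sum_filter, Finset.sum_const, hset, Fin.card_Ici, nsmul_eq_mul,
          Nat.sub_sub_self hkN]

/-- If `u` plus a paraboloid of opening `c` has a local maximum at `x`, then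
`P⁺ₖ(D²u(x)) ≤ -kc`. -/
theorem Pplus_hessianMatrix_le {N k : ℕ} (hk1 : 1 ≤ k) (hkN : k ≤ N)
    {u : EuclideanSpace ℝ (Fin N) → ℝ} {x x₀ : EuclideanSpace ℝ (Fin N)} {c : ℝ}
    (hu : ContDiffAt ℝ 2 u x)
    (hmax : IsLocalMax (fun y => u y + c / 2 * ‖y - x₀‖ ^ 2) x) :
    Pplus k (hessianMatrix u x) ≤ k * -c := by
  have hA := isHermitian_hessianMatrix hu
  refine Pplus_le hk1 hkN fun i => ?_
  rw [sortedEig, dif_pos hA]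
  refine hA.eigenvalues_le (fun w => ?_) _
  rw [dotProduct_hessianMatrix_mulVec hu]
  exact fderiv_fderiv_le_of_isLocalMax_add_sq hu hmax w

/-- **classical maximum principle for `P⁺ₖ` with zero order term.**
If `u ∈ C(Ω̄) ∩ C²(Ω)` satisfies `P⁺ₖ(D²u) ≥ f` in a bounded open `Ω`, with `f`
continuous and bounded, then
`sup_Ω u ≤ sup_{∂Ω} u + (diam Ω)²/(2k) · sup_Ω f⁻`. -/
theorem max_principle_pplus {N : ℕ} (k : ℕ) (hk1 : 1 ≤ k) (hkN : k ≤ N)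
    (Ω : Set (EuclideanSpace ℝ (Fin N))) (hΩo : IsOpen Ω)
    (hΩb : Bornology.IsBounded Ω)
    (u f : EuclideanSpace ℝ (Fin N) → ℝ)
    (huc : ContinuousOn u (closure Ω)) (hu2 : ContDiffOn ℝ 2 u Ω)
    (hfc : ContinuousOn f Ω) (hfb : ∃ M, ∀ x ∈ Ω, |f x| ≤ M)
    (hsub : ∀ x ∈ Ω, f x ≤ Pplus k (hessianMatrix u x)) :
    ∀ x ∈ Ω, u x ≤ sSup (u '' frontier Ω) +
      Metric.diam Ω ^ 2 / (2 * k) * sSup ((fun y => max (-f y) 0) '' Ω) := by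
  intro x hx
  set F := sSup ((fun y => max (-f y) 0) '' Ω)
  have hkpos : (0 : ℝ) < k := by exact_mod_cast hk1
  have hfF : ∀ y ∈ Ω, -F ≤ f y := by
    intro y hy
    obtain ⟨M, hM⟩ := hfb
    have hbdd : BddAbove ((fun y => max (-f y) 0) '' Ω) := by
      refine ⟨M, ?_⟩
      rintro _ ⟨z, hz, rfl⟩
      exact max_le ((neg_le_abs _).trans (hM z hz)) ((abs_nonneg _).trans (hM z hz))
    have := (le_max_left (-f y) 0).trans (le_csSup hbdd ⟨y, hy, rfl⟩)
    linarith
  have hF0 : 0 ≤ F := by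
    refine Real.sSup_nonneg ?_
    rintro _ ⟨z, -, rfl⟩
    exact le_max_right _ _
  have hcompact : IsCompact (closure Ω) := hΩb.isCompact_closure
  have hbddu : BddAbove (u '' frontier Ω) :=
    (hcompact.bddAbove_image huc).mono (Set.image_mono frontier_subset_closure)
  have key : ∀ ε > 0, u x ≤ sSup (u '' frontier Ω) +
      Metric.diam Ω ^ 2 / (2 * k) * (F + ε) := by
    intro ε hε
    set c : ℝ := (F + ε) / k with hc
    have hcpos : 0 ≤ c := by positivity
    obtain ⟨z, hz, hzmax⟩ := hcompact.exists_isMaxOn ⟨x, subset_closure hx⟩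
      (f := fun y => u y + c / 2 * ‖y - x‖ ^ 2) (huc.add (by fun_prop))
    have hzΩ : z ∉ Ω := by
      intro hzΩ
      have hnhds : Ω ∈ nhds z := hΩo.mem_nhds hzΩ
      have hle := Pplus_hessianMatrix_le hk1 hkN (hu2.contDiffAt hnhds)
        (hzmax.isLocalMax (Filter.mem_of_superset hnhds subset_closure))
      have hkc : (k : ℝ) * -c = -(F + ε) := by
        rw [hc]
        field_simp
      linarith [hsub z hzΩ, hfF z hzΩ]
    have hzfr : z ∈ frontier Ω := hΩo.frontier_eq ▸ ⟨hz, hzΩ⟩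
    have huz : u z ≤ sSup (u '' frontier Ω) := le_csSup hbddu ⟨z, hzfr, rfl⟩
    have hdist : ‖z - x‖ ≤ Metric.diam Ω := by
      rw [← dist_eq_norm, ← Metric.diam_closure]
      exact Metric.dist_le_diam_of_mem hΩb.closure hz (subset_closure hx)
    have hxz : u x ≤ u z + c / 2 * ‖z - x‖ ^ 2 := by
      simpa using hzmax (subset_closure hx)
    calc u x ≤ u z + c / 2 * ‖z - x‖ ^ 2 := hxz
      _ ≤ sSup (u '' frontier Ω) + c / 2 * Metric.diam Ω ^ 2 := by gcongr
      _ = sSup (u '' frontier Ω) + Metric.diam Ω ^ 2 / (2 * k) * (F + ε) := by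
          rw [hc]
          field_simp
  have hlim : Filter.Tendsto (fun ε : ℝ => sSup (u '' frontier Ω) +
      Metric.diam Ω ^ 2 / (2 * k) * (F + ε)) (nhdsWithin 0 (Set.Ioi 0))
      (nhds (sSup (u '' frontier Ω) + Metric.diam Ω ^ 2 / (2 * k) * (F + 0))) :=
    Continuous.continuousWithinAt (by fun_prop)
  rw [add_zero] at hlim
  exact ge_of_tendsto hlim (Filter.eventually_of_mem self_mem_nhdsWithin key)
end

section
/- (C¹ regularity and gradient bound for the glued radial subsolution.) Let N ≥ 2, k ≥ 1 an integer, p ∈ (0,1), z ∈ ℝ^N and 0 < δ ≤ R. Define v_z : ℝ^N → ℝ by v_z(x) = [ ((1−p)/(2k)) (δ² − |x−z|²) ]^{1/(1−p)} if |x−z| ≤ δ and v_z(x) = 0 otherwise. Then v_z is continuously differentiable on all of ℝ^N and its gradient satisfies the uniform bound |∇v_z(x)| ≤ ( ((1−p)/(1+p))^{(1+p)/2} R^{1+p} / k )^{1/(1−p)} for every x ∈ ℝ^N. -/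
theorem hasDerivAt_max_zero_rpow {q : ℝ} (hq : 1 < q) (t : ℝ) :
    HasDerivAt (fun t : ℝ => (max t 0) ^ q) (q * (max t 0) ^ (q - 1)) t := by
  have hcont : ∀ r : ℝ, 0 < r → Continuous fun t : ℝ => (max t 0) ^ r := fun r hr =>
    (continuous_id.max continuous_const).rpow_const fun _ => Or.inr hr.le
  have hne : ∀ y : ℝ, y ≠ 0 →
      HasDerivAt (fun t : ℝ => (max t 0) ^ q) (q * (max y 0) ^ (q - 1)) y := by
    intro y hy
    rcases lt_or_gt_of_ne hy with h | h
    · rw [max_eq_right h.le, Real.zero_rpow (by linarith), mul_zero]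
      refine (hasDerivAt_const y (0 : ℝ)).congr_of_eventuallyEq ?_
      filter_upwards [eventually_lt_nhds h] with s hs
      rw [max_eq_right hs.le, Real.zero_rpow (by linarith)]
    · rw [max_eq_left h.le]
      refine (Real.hasDerivAt_rpow_const (Or.inl hy)).congr_of_eventuallyEq ?_
      filter_upwards [eventually_gt_nhds h] with s hs
      rw [max_eq_left hs.le]
  rcases eq_or_ne t 0 with rfl | ht
  · exact hasDerivAt_of_hasDerivAt_of_ne hne (hcont q (by linarith)).continuousAt
      (continuous_const.mul (hcont (q - 1) (by linarith))).continuousAt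
  · exact hne t ht

theorem contDiff_one_max_zero_rpow {q : ℝ} (hq : 1 < q) :
    ContDiff ℝ 1 fun t : ℝ => (max t 0) ^ q := by
  refine contDiff_one_iff_deriv.2
    ⟨fun t => (hasDerivAt_max_zero_rpow hq t).differentiableAt, ?_⟩
  rw [funext fun t => (hasDerivAt_max_zero_rpow hq t).deriv]
  exact continuous_const.mul
    ((continuous_id.max continuous_const).rpow_const fun _ => Or.inr (by linarith))

theorem radial_gradient_bound {p κ δ R r : ℝ} (hp : p ∈ Set.Ioo (0 : ℝ) 1) (hκ : 0 < κ)
    (hr : 0 ≤ r) (hrδ : r ≤ δ) (hδR : δ ≤ R) :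
    ((1 - p) / (2 * κ) * (δ ^ 2 - r ^ 2)) ^ (p / (1 - p)) * (r / κ) ≤
      (((1 - p) / (1 + p)) ^ ((1 + p) / 2) * R ^ (1 + p) / κ) ^ (1 / (1 - p)) := by
  obtain ⟨hp0, hp1⟩ := hp
  have hq : 0 < 1 - p := by linarith
  have hs : 0 < 1 + p := by linarith
  have hR : 0 ≤ R := by linarith
  have ht : 0 ≤ δ ^ 2 - r ^ 2 := by nlinarith
  set T := (1 - p) / 2 * (δ ^ 2 - r ^ 2) with hT
  have hT0 : 0 ≤ T := by positivity
  have hw : 0 < (1 - p) / (1 + p) := by positivity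
  have hamgm : (r ^ 2) ^ ((1 - p) / (1 + p)) * T ^ (2 * p / (1 + p)) ≤
      (1 - p) / (1 + p) * R ^ 2 := by
    refine (Real.geom_mean_le_arith_mean2_weighted hw.le (by positivity) (sq_nonneg r) hT0
      (by field_simp; ring)).trans ?_
    have h : 2 * p / (1 + p) * T = (1 - p) / (1 + p) * (p * (δ ^ 2 - r ^ 2)) := by
      rw [hT]; field_simp
    rw [h, ← mul_add]
    exact mul_le_mul_of_nonneg_left (by nlinarith) hw.le
  have hpow : r ^ (1 - p) * T ^ p ≤ ((1 - p) / (1 + p)) ^ ((1 + p) / 2) * R ^ (1 + p) := by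
    have h := Real.rpow_le_rpow (by positivity) hamgm (show 0 ≤ (1 + p) / 2 by positivity)
    rw [Real.mul_rpow (by positivity) (by positivity), Real.mul_rpow hw.le (by positivity),
      ← Real.rpow_natCast r, ← Real.rpow_natCast R, ← Real.rpow_mul hr, ← Real.rpow_mul hr,
      ← Real.rpow_mul hT0, ← Real.rpow_mul hR] at h
    convert h using 3 <;> push_cast <;> field_simp
  have hbase : (r / κ) ^ (1 - p) * (T / κ) ^ p ≤
      ((1 - p) / (1 + p)) ^ ((1 + p) / 2) * R ^ (1 + p) / κ := by
    rw [Real.div_rpow hr hκ.le, Real.div_rpow hT0 hκ.le, div_mul_div_comm, ← Real.rpow_add hκ,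
      sub_add_cancel, Real.rpow_one]
    exact div_le_div_of_nonneg_right hpow hκ.le
  have h := Real.rpow_le_rpow (by positivity) hbase (show 0 ≤ 1 / (1 - p) by positivity)
  rw [Real.mul_rpow (by positivity) (by positivity), ← Real.rpow_mul (by positivity),
    ← Real.rpow_mul (by positivity), mul_one_div_cancel hq.ne', Real.rpow_one, mul_one_div,
    mul_comm] at h
  have hTκ : (1 - p) / (2 * κ) * (δ ^ 2 - r ^ 2) = T / κ := by
    rw [hT]; field_simp
  rwa [hTκ]

/-- **C¹ regularity and gradient bound for the glued radial
subsolution.** The function obtained by gluing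
`[((1-p)/(2k))(δ²-|x-z|²)]^{1/(1-p)}` on `B_δ(z)` with `0` outside is `C¹` on `ℝ^N`,
with gradient bounded by `(((1-p)/(1+p))^{(1+p)/2} R^{1+p}/k)^{1/(1-p)}`. -/
theorem glued_subsolution_C1 {N : ℕ} (hN : 2 ≤ N) (k : ℕ) (hk : 1 ≤ k)
    (p : ℝ) (hp : p ∈ Set.Ioo (0 : ℝ) 1)
    (z : EuclideanSpace ℝ (Fin N)) (δ R : ℝ) (hδ : 0 < δ) (hδR : δ ≤ R)
    (v : EuclideanSpace ℝ (Fin N) → ℝ)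
    (hv : ∀ x, v x = if ‖x - z‖ ≤ δ
      then ((1 - p) / (2 * k) * (δ ^ 2 - ‖x - z‖ ^ 2)) ^ (1 / (1 - p)) else 0) :
    ContDiff ℝ 1 v ∧
    ∀ x : EuclideanSpace ℝ (Fin N),
      ‖fderiv ℝ v x‖ ≤
        (((1 - p) / (1 + p)) ^ ((1 + p) / 2) * R ^ (1 + p) / k) ^ (1 / (1 - p)) := by
  have hp0 : 0 < p := hp.1
  have hq : 0 < 1 - p := by linarith [hp.2]
  have hq1 : 1 < 1 / (1 - p) := by rw [lt_div_iff₀ hq]; linarith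
  have hk0 : (0 : ℝ) < k := by exact_mod_cast hk
  set c : ℝ := (1 - p) / (2 * k) with hc
  have hc0 : 0 < c := by positivity
  have hveq : v = fun x => (max (c * (δ ^ 2 - ‖x - z‖ ^ 2)) 0) ^ (1 / (1 - p)) := by
    funext x
    rw [hv]
    split_ifs with h
    · rw [max_eq_left (mul_nonneg hc0.le (by nlinarith [norm_nonneg (x - z)]))]
    · rw [max_eq_right (mul_nonpos_of_nonneg_of_nonpos hc0.le (by nlinarith)),
        Real.zero_rpow (by positivity)]
  have hinner : ∀ x, HasFDerivAt (fun x => c * (δ ^ 2 - ‖x - z‖ ^ 2))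
      (c • (-((2 : ℕ) • innerSL ℝ (x - z)) : EuclideanSpace ℝ (Fin N) →L[ℝ] ℝ)) x := fun x =>
    ((((hasFDerivAt_id x).sub_const z).norm_sq).const_sub (δ ^ 2)).const_mul c
  refine ⟨?_, fun x => ?_⟩
  · rw [hveq]
    exact (contDiff_one_max_zero_rpow hq1).comp
      (contDiff_const.mul (contDiff_const.sub ((contDiff_id.sub contDiff_const).norm_sq ℝ)))
  have hderiv := (hasDerivAt_max_zero_rpow hq1 _).comp_hasFDerivAt x (hinner x)
  have hexp : 1 / (1 - p) - 1 = p / (1 - p) := by field_simp; ring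
  have hnorm : ‖fderiv ℝ v x‖ =
      (max (c * (δ ^ 2 - ‖x - z‖ ^ 2)) 0) ^ (p / (1 - p)) * (‖x - z‖ / k) := by
    have hfd := (hderiv.congr_of_eventuallyEq (Filter.EventuallyEq.of_eq hveq)).fderiv
    rw [hfd, hexp, ← Nat.cast_smul_eq_nsmul ℝ, norm_smul, norm_smul, norm_neg, norm_smul,
      innerSL_apply_norm, Real.norm_of_nonneg (by positivity), Real.norm_of_nonneg hc0.le,
      Real.norm_of_nonneg (by positivity), hc]
    push_cast
    field_simp
  rw [hnorm]
  rcases le_total ‖x - z‖ δ with h | h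
  · rw [max_eq_left (mul_nonneg hc0.le (by nlinarith [norm_nonneg (x - z)]))]
    exact radial_gradient_bound hp hk0 (norm_nonneg _) h hδR
  · rw [max_eq_right (mul_nonpos_of_nonneg_of_nonpos hc0.le (by nlinarith)),
      Real.zero_rpow (by positivity), zero_mul]
    have : 0 ≤ R := by linarith
    positivity
end
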